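/- Let V be a finite set of n records and let ℬ = {B_1, …, B_m} be a family of first-layer blocks B_j ⊆ V such that every record u ∈ V belongs to at most γ blocks of ℬ. Fix a depth d, and let the intersection block hierarchy consist of all nonempty intersections ⋂_{j∈S} B_j over index sets S ⊆ {1, …, m} with 1 ≤ |S| ≤ d. Then the number of index sets S with 1 ≤ |S| ≤ d whose intersection ⋂_{j∈S} B_j is nonempty — and hence the number of blocks present in the hierarchy — is at most n · Σ_{i=1}^{d} C(γ, i); in particular, it is O(n) when γ and d are constants. -/

import Mathlib

/--
Let `V` be a finite set of `n` records, `B : Fin m → Finset V` a family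
of first-layer blocks such that every record belongs to at most `γ` blocks. The number of
index sets `S` with `1 ≤ |S| ≤ d` whose intersection `⋂_{j ∈ S} B j` is nonempty — hence
the number of blocks in the intersection block hierarchy of depth `d` — is at most
`n * ∑_{i=1}^{d} (γ choose i)`.
-/
theorem block_hierarchy_card_le {V : Type*} [Fintype V] (n m γ d : ℕ)
    (hn : Fintype.card V = n)
    (B : Fin m → Finset V)
    (hγ : ∀ u : V, {j : Fin m | u ∈ B j}.ncard ≤ γ) :
    {S : Finset (Fin m) | 1 ≤ S.card ∧ S.card ≤ d ∧ ∃ u : V, ∀ j ∈ S, u ∈ B j}.ncard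
      ≤ n * ∑ i ∈ Finset.Icc 1 d, Nat.choose γ i := by
  classical
  let J : V → Finset (Fin m) := fun u => Finset.univ.filter fun j => u ∈ B j
  have hJ (u : V) : (J u).card ≤ γ := by
    rw [← Set.ncard_coe_finset]
    simpa [J] using hγ u
  let T : V → Finset (Finset (Fin m)) := fun u =>
    (Finset.Icc 1 d).biUnion fun i => (J u).powersetCard i
  have hT (u : V) : (T u).card ≤ ∑ i ∈ Finset.Icc 1 d, Nat.choose γ i := by
    refine Finset.card_biUnion_le.trans (Finset.sum_le_sum fun i _ => ?_)
    rw [Finset.card_powersetCard]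
    exact Nat.choose_le_choose i (hJ u)
  have hsub : {S : Finset (Fin m) | 1 ≤ S.card ∧ S.card ≤ d ∧ ∃ u : V, ∀ j ∈ S, u ∈ B j} ⊆
      (Finset.univ.biUnion T : Finset (Finset (Fin m))) := by
    rintro S ⟨h1, hd, u, hu⟩
    rw [Finset.mem_coe, Finset.mem_biUnion]
    refine ⟨u, Finset.mem_univ u, Finset.mem_biUnion.2
      ⟨S.card, Finset.mem_Icc.2 ⟨h1, hd⟩, Finset.mem_powersetCard.2 ⟨fun j hj => ?_, rfl⟩⟩⟩
    simpa [J] using hu j hj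
  refine (Set.ncard_le_ncard hsub (Finset.finite_toSet _)).trans ?_
  rw [Set.ncard_coe_finset, ← hn]
  exact Finset.card_biUnion_le_card_mul _ _ _ fun u _ => hT u
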